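/- There exist a real constant c > 0 and a natural number n₀ such that for every n ≥ n₀ there is an oriented graph G on a finite vertex type with at most c · n² · (log n)² edges such that for every 2-coloring of the edges of G with colors red and blue, G contains a red directed path with at least n edges or a blue directed path with at least ⌊n · log n⌋ edges. -/

import Mathlib

/-- A directed path with `m` edges in the digraph with adjacency `Adj`. -/
def IsDiPath {V : Type} (Adj : V → V → Prop) {m : ℕ} (p : Fin (m + 1) → V) : Prop :=
  Function.Injective p ∧ ∀ i : Fin m, Adj (p i.castSucc) (p i.succ)

/-- An oriented graph: irreflexive adjacency with no antiparallel edges. -/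
def IsOriented {V : Type} (Adj : V → V → Prop) : Prop :=
  Irreflexive Adj ∧ ∀ u v : V, ¬ (Adj u v ∧ Adj v u)

/-- A path is monochromatic of color `col` w.r.t. a 2-coloring `c : V → V → Bool`
(we take `true` to be red and `false` to be blue). -/
def IsColored {V : Type} (c : V → V → Bool) (col : Bool) {m : ℕ}
    (p : Fin (m + 1) → V) : Prop :=
  ∀ i : Fin m, c (p i.castSucc) (p i.succ) = col

theorem exists_chain_append {α : Type*} {ρ : α → α → Prop} {k : ℕ} {P Q : List α}
    (hP : P.IsChain ρ) (hQ : Q.IsChain ρ)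
    (h : ∀ A B : List α, A.Sublist P → B.Sublist Q → A.length = k → B.length = k →
      ∃ a ∈ A, ∃ b ∈ B, ρ a b) :
    ∃ P' Q' : List α, P'.Sublist P ∧ Q'.Sublist Q ∧ P.length ≤ P'.length + k ∧
      Q.length ≤ Q'.length + k ∧ (P' ++ Q').IsChain ρ := by
  rcases le_or_gt P.length k with hPk | hPk
  · exact ⟨[], Q, by simp, by simp, by simpa using hPk, by simp, by simpa using hQ⟩
  rcases le_or_gt Q.length k with hQk | hQk
  · exact ⟨P, [], by simp, by simp, by simp, by simpa using hQk, by simpa using hP⟩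
  obtain ⟨a, ha, b, hb, hab⟩ := h (P.drop (P.length - k)) (Q.take k)
    (List.drop_sublist _ _) (List.take_sublist _ _) (by simp; omega) (by simp; omega)
  obtain ⟨i, hi, rfl⟩ := List.mem_iff_getElem.1 ha
  obtain ⟨j, hj, rfl⟩ := List.mem_iff_getElem.1 hb
  simp only [List.length_drop, List.length_take] at hi hj
  refine ⟨P.take (P.length - k + i + 1), Q.drop j, List.take_sublist _ _, List.drop_sublist _ _,
    by simp; omega, by simp; omega, ?_⟩
  rw [List.isChain_append]
  refine ⟨hP.take _, hQ.drop _, ?_⟩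
  intro x hx y hy
  rw [List.getLast?_take, if_neg (by omega)] at hx
  rw [List.head?_drop] at hy
  simp only [Nat.add_sub_cancel] at hx
  rw [List.getElem?_eq_getElem (by omega)] at hx hy
  simp at hx hy
  subst hx hy
  simpa using hab

theorem exists_dfs {α : Type*} [DecidableEq α] (ρ : α → α → Prop) (U : Finset α) :
    ∃ (S T : Finset α) (P : List α), S ⊆ U ∧ T ⊆ U ∧ Disjoint S T ∧ P.Nodup ∧ P.IsChain ρ ∧
      (∀ v ∈ P, v ∈ U) ∧ S.card = T.card ∧ U.card = 2 * S.card + P.length ∧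
      ∀ s ∈ S, ∀ t ∈ T, ¬ ρ s t := by
  have key : ∀ j ≤ U.card, ∃ (S T : Finset α) (P : List α), S ⊆ U ∧ T ⊆ U ∧ Disjoint S T ∧
      P.Nodup ∧ P.IsChain (fun a b => ρ b a) ∧ (∀ v ∈ P, v ∈ U ∧ v ∉ S ∧ v ∉ T) ∧
      S.card + U.card = T.card + j ∧ U.card = S.card + T.card + P.length ∧
      ∀ s ∈ S, ∀ t ∈ T, ¬ ρ s t := by
    intro j
    induction j with
    | zero => exact fun _ => ⟨∅, U, [], by simp⟩
    | succ j ih =>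
      intro hj
      obtain ⟨S, T, P, hS, hT, hST, hn, hc, hP, h1, h2, h3⟩ := ih (by omega)
      have push : ∀ t ∈ T, (t :: P).IsChain (fun a b => ρ b a) →
          ∃ (S T : Finset α) (P : List α), S ⊆ U ∧ T ⊆ U ∧ Disjoint S T ∧
          P.Nodup ∧ P.IsChain (fun a b => ρ b a) ∧ (∀ v ∈ P, v ∈ U ∧ v ∉ S ∧ v ∉ T) ∧
          S.card + U.card = T.card + (j + 1) ∧ U.card = S.card + T.card + P.length ∧
          ∀ s ∈ S, ∀ t ∈ T, ¬ ρ s t := by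
        intro t ht hch
        have hcard := Finset.card_erase_add_one ht
        refine ⟨S, T.erase t, t :: P, hS, (Finset.erase_subset _ _).trans hT,
          hST.mono_right (Finset.erase_subset _ _), ?_, hch, ?_, by omega,
          by simp only [List.length_cons]; omega,
          fun s hs t ht => h3 s hs t (Finset.mem_of_mem_erase ht)⟩
        · exact List.nodup_cons.2 ⟨fun h => (hP t h).2.2 ht, hn⟩
        · intro v hv
          rcases List.mem_cons.1 hv with rfl | hv
          · exact ⟨hT ht, Finset.disjoint_right.1 hST ht, by simp⟩
          · exact ⟨(hP v hv).1, (hP v hv).2.1, fun h => (hP v hv).2.2 (Finset.mem_of_mem_erase h)⟩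
      cases P with
      | nil =>
        have hTne : T.Nonempty := by
          rw [← Finset.card_pos]; omega
        obtain ⟨t, ht⟩ := hTne
        exact push t ht (by simp)
      | cons p P =>
        by_cases hex : ∃ t ∈ T, ρ p t
        · obtain ⟨t, ht, hpt⟩ := hex
          exact push t ht (List.isChain_cons_cons.2 ⟨hpt, hc⟩)
        · push Not at hex
          have hp := hP p (by simp)
          have hcard := Finset.card_insert_of_notMem hp.2.1
          rw [List.nodup_cons] at hn
          refine ⟨insert p S, T, P, Finset.insert_subset hp.1 hS, hT,
            Finset.disjoint_insert_left.2 ⟨hp.2.2, hST⟩, hn.2, hc.tail, ?_, by omega,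
            by simp only [List.length_cons] at h2; omega, ?_⟩
          · intro v hv
            have := hP v (by simp [hv])
            refine ⟨this.1, ?_, this.2.2⟩
            rw [Finset.mem_insert, not_or]
            exact ⟨fun h => hn.1 (h ▸ hv), this.2.1⟩
          · intro s hs t ht
            rcases Finset.mem_insert.1 hs with rfl | hs
            · exact hex t ht
            · exact h3 s hs t ht
  obtain ⟨S, T, P, hS, hT, hST, hn, hc, hP, h1, h2, h3⟩ := key _ le_rfl
  refine ⟨S, T, P.reverse, hS, hT, hST, by simpa using hn, ?_,
    fun v hv => (hP v (by simpa using hv)).1, by omega, by simp; omega, h3⟩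
  rw [List.isChain_reverse]
  exact hc

theorem exists_maximal_matching {V : Type*} [DecidableEq V] (B : V → V → Prop)
    {S T : Finset V} (hST : S.card = T.card) :
    ∃ (M : List (V × V)) (S' T' : Finset V), S' ⊆ S ∧ T' ⊆ T ∧ S'.card + M.length = S.card ∧
      T'.card + M.length = T.card ∧ (M.map Prod.fst).Nodup ∧ (M.map Prod.snd).Nodup ∧
      (∀ e ∈ M, e.1 ∈ T ∧ e.1 ∉ T' ∧ e.2 ∈ S ∧ e.2 ∉ S' ∧ B e.1 e.2) ∧
      ∀ t ∈ T', ∀ s ∈ S', ¬ B t s := by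
  induction hn : S.card generalizing S T with
  | zero =>
    refine ⟨[], S, T, by simp, by simp, by simpa using hn, by simp, by simp, by simp, by simp, ?_⟩
    rw [Finset.card_eq_zero] at hn
    simp [hn]
  | succ n ih =>
    by_cases hex : ∃ t ∈ T, ∃ s ∈ S, B t s
    · obtain ⟨t, ht, s, hs, hB⟩ := hex
      have h1 := Finset.card_erase_add_one ht
      have h2 := Finset.card_erase_add_one hs
      obtain ⟨M, S', T', hS', hT', c1, c2, n1, n2, hM, hno⟩ :=
        ih (S := S.erase s) (T := T.erase t) (by omega) (by omega)
      refine ⟨(t, s) :: M, S', T', hS'.trans (Finset.erase_subset _ _),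
        hT'.trans (Finset.erase_subset _ _), by simp; omega, by simp; omega, ?_, ?_, ?_, hno⟩
      · rw [List.map_cons, List.nodup_cons]
        refine ⟨fun h => ?_, n1⟩
        obtain ⟨e, he, het⟩ := List.mem_map.1 h
        exact (Finset.mem_erase.1 (hM e he).1).1 het
      · rw [List.map_cons, List.nodup_cons]
        refine ⟨fun h => ?_, n2⟩
        obtain ⟨e, he, hes⟩ := List.mem_map.1 h
        exact (Finset.mem_erase.1 (hM e he).2.2.1).1 hes
      · intro e he
        rcases List.mem_cons.1 he with rfl | he
        · exact ⟨ht, fun h => by simpa using hT' h, hs, fun h => by simpa using hS' h, hB⟩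
        · obtain ⟨a, b, c, d, e⟩ := hM e he
          exact ⟨Finset.mem_of_mem_erase a, b, Finset.mem_of_mem_erase c, d, e⟩
    · push Not at hex
      exact ⟨[], S, T, by simp, by simp, by simpa using hn, by simp, by simp, by simp, by simp, hex⟩

/-- Every two disjoint `k`-sets span an edge from the first to the second. -/
def IsJoined {V : Type*} (Adj : V → V → Prop) (k : ℕ) : Prop :=
  ∀ A B : Finset V, Disjoint A B → A.card = k → B.card = k → ∃ a ∈ A, ∃ b ∈ B, Adj a b

/-- The tournament on `Fin N` in which `f` selects the pairs oriented upwards. -/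
def tournament {N : ℕ} (f : Fin N × Fin N → Bool) (u v : Fin N) : Prop :=
  (u < v ∧ f (u, v) = true) ∨ (v < u ∧ f (v, u) = false)

theorem isOriented_tournament {N : ℕ} (f : Fin N × Fin N → Bool) :
    IsOriented (tournament f) := by
  constructor
  · intro u
    simp [tournament]
  · rintro u v ⟨h1 | h1, h2 | h2⟩
    · exact absurd h1.1 h2.1.asymm
    · simp [h1.2] at h2
    · simp [h1.2] at h2
    · exact absurd h1.1 h2.1.asymm

theorem card_not_joined_le {N k : ℕ} {A B : Finset (Fin N)} (hAB : Disjoint A B)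
    (hA : A.card = k) (hB : B.card = k) [DecidablePred fun f : Fin N × Fin N → Bool =>
      ∀ a ∈ A, ∀ b ∈ B, ¬ tournament f a b] :
    (Finset.univ.filter fun f : Fin N × Fin N → Bool =>
      ∀ a ∈ A, ∀ b ∈ B, ¬ tournament f a b).card * 2 ^ (k * k) ≤ 2 ^ (N * N) := by
  classical
  set D : Finset (Fin N × Fin N) := (A ×ˢ B).image fun p => (min p.1 p.2, max p.1 p.2) with hD
  have hDcard : D.card = k * k := by
    rw [hD, Finset.card_image_of_injOn, Finset.card_product, hA, hB]
    rintro ⟨a, b⟩ hp ⟨a', b'⟩ hq h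
    simp only [Finset.coe_product, Set.mem_prod, Finset.mem_coe] at hp hq
    simp only [Prod.mk.injEq] at h ⊢
    have h1 : a ≠ b' := fun h => Finset.disjoint_left.1 hAB hp.1 (h ▸ hq.2)
    have h2 : a' ≠ b := fun h => Finset.disjoint_left.1 hAB hq.1 (h ▸ hp.2)
    rcases le_total a b with h3 | h3 <;> rcases le_total a' b' with h4 | h4 <;>
      simp_all
  set F : Finset (Fin N × Fin N → Bool) :=
    Fintype.piFinset fun x => if x ∈ D then {decide (x.1 ∉ A)} else Finset.univ with hF
  have hsub : (Finset.univ.filter fun f : Fin N × Fin N → Bool =>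
      ∀ a ∈ A, ∀ b ∈ B, ¬ tournament f a b) ⊆ F := by
    intro f hf
    rw [Finset.mem_filter] at hf
    rw [hF, Fintype.mem_piFinset]
    intro x
    split_ifs with hx
    · obtain ⟨⟨a, b⟩, hp, rfl⟩ := Finset.mem_image.1 hx
      rw [Finset.mem_product] at hp
      have hab : a ≠ b := fun h => Finset.disjoint_left.1 hAB hp.1 (h ▸ hp.2)
      have hbA : b ∉ A := Finset.disjoint_right.1 hAB hp.2
      have := hf.2 a hp.1 b hp.2
      rcases lt_or_gt_of_ne hab with h | h
      · simp_all [tournament, h.le]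
      · simp_all [tournament, h.le]
    · simp
  have hFcard : F.card * 2 ^ (k * k) = 2 ^ (N * N) := by
    have hc : ∀ x : Fin N × Fin N,
        (if x ∈ D then {decide (x.1 ∉ A)} else Finset.univ : Finset Bool).card
          = if x ∈ D then 1 else 2 := by
      intro x; split_ifs <;> simp
    rw [hF, Fintype.card_piFinset, Finset.prod_congr rfl (fun x _ => hc x), ← hDcard,
      Finset.prod_ite]
    have hfil : (Finset.univ.filter fun x => x ∈ D) = D := by ext; simp
    have hsum := Finset.card_filter_add_card_filter_not (s := Finset.univ) (fun x => x ∈ D)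
    rw [hfil, Finset.card_univ, Fintype.card_prod, Fintype.card_fin] at hsum
    simp only [Finset.prod_const_one, one_mul, Finset.prod_const]
    rw [← pow_add, add_comm, hsum]
  calc _ ≤ F.card * 2 ^ (k * k) := Nat.mul_le_mul_right _ (Finset.card_le_card hsub)
    _ = _ := hFcard

theorem exists_tournament_isJoined {N k : ℕ} (h : (N ^ k) ^ 2 < 2 ^ (k * k)) :
    ∃ Adj : Fin N → Fin N → Prop, IsOriented Adj ∧ IsJoined Adj k := by
  classical
  by_contra! hcon
  set I : Finset (Finset (Fin N) × Finset (Fin N)) :=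
    ((Finset.univ.powersetCard k) ×ˢ (Finset.univ.powersetCard k)).filter
      fun p => Disjoint p.1 p.2 with hI
  set bad : Finset (Fin N) × Finset (Fin N) → Finset (Fin N × Fin N → Bool) :=
    fun p => Finset.univ.filter fun f => ∀ a ∈ p.1, ∀ b ∈ p.2, ¬ tournament f a b with hbad
  have hcover : (Finset.univ : Finset (Fin N × Fin N → Bool)) ⊆ I.biUnion bad := by
    intro f _
    have := hcon _ (isOriented_tournament f)
    simp only [IsJoined] at this
    push Not at this
    obtain ⟨A, B, hAB, hA, hB, hno⟩ := this
    exact Finset.mem_biUnion.2 ⟨(A, B), by simp [hI, hAB, hA, hB], by simpa [hbad] using hno⟩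
  have h1 : 2 ^ (N * N) ≤ ∑ p ∈ I, (bad p).card := by
    have := (Finset.card_le_card hcover).trans Finset.card_biUnion_le
    simpa using this
  have h2 : (∑ p ∈ I, (bad p).card) * 2 ^ (k * k) ≤ I.card * 2 ^ (N * N) := by
    rw [Finset.sum_mul, ← smul_eq_mul I.card]
    refine Finset.sum_le_card_nsmul _ _ _ fun p hp => ?_
    simp only [hI, Finset.mem_filter, Finset.mem_product, Finset.mem_powersetCard] at hp
    exact card_not_joined_le hp.2 hp.1.1.2 hp.1.2.2
  have h3 : I.card ≤ (N ^ k) ^ 2 := by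
    refine (Finset.card_filter_le _ _).trans ?_
    rw [Finset.card_product, Finset.card_powersetCard, Finset.card_univ, Fintype.card_fin, ← sq]
    exact Nat.pow_le_pow_left (Nat.choose_le_pow _ _) 2
  have h4 : 2 ^ (N * N) * 2 ^ (k * k) ≤ 2 ^ (N * N) * (N ^ k) ^ 2 := by
    calc _ ≤ _ := Nat.mul_le_mul_right _ h1
      _ ≤ _ := h2
      _ ≤ _ := Nat.mul_le_mul_right _ h3
      _ = _ := mul_comm _ _
  exact absurd (Nat.le_of_mul_le_mul_left h4 (by positivity)) (not_le.2 h)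

/-- `P` is the vertex sequence of a directed path of the relation `R` inside `U`. -/
def IsPathIn {V : Type*} (R : V → V → Prop) (U : Finset V) (P : List V) : Prop :=
  P.Nodup ∧ P.IsChain R ∧ ∀ v ∈ P, v ∈ U

/-- All edges of `Adj` from `X` to `Y` belong to `R`. -/
def EdgesIn {V : Type*} (Adj R : V → V → Prop) (X Y : Finset V) : Prop :=
  ∀ x ∈ X, ∀ y ∈ Y, Adj x y → R x y

theorem EdgesIn.mono {V : Type*} {Adj R : V → V → Prop} {X Y X' Y' : Finset V}
    (h : EdgesIn Adj R X Y) (hX : X' ⊆ X) (hY : Y' ⊆ Y) : EdgesIn Adj R X' Y' :=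
  fun x hx y hy => h x (hX hx) y (hY hy)

theorem IsJoined.exists_list {V α β : Type*} [DecidableEq V] {Adj R : V → V → Prop} {k : ℕ}
    (hG : IsJoined Adj k) {X Y : Finset V} (hXY : Disjoint X Y) (hE : EdgesIn Adj R X Y)
    {f : α → V} {g : β → V} {A : List α} {B : List β} (hA : (A.map f).Nodup)
    (hB : (B.map g).Nodup) (hAX : ∀ a ∈ A, f a ∈ X) (hBY : ∀ b ∈ B, g b ∈ Y)
    (hAk : A.length = k) (hBk : B.length = k) : ∃ a ∈ A, ∃ b ∈ B, R (f a) (g b) := by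
  have h1 : (A.map f).toFinset ⊆ X := by
    intro v hv
    obtain ⟨a, ha, rfl⟩ := List.mem_map.1 (List.mem_toFinset.1 hv)
    exact hAX a ha
  have h2 : (B.map g).toFinset ⊆ Y := by
    intro v hv
    obtain ⟨a, ha, rfl⟩ := List.mem_map.1 (List.mem_toFinset.1 hv)
    exact hBY a ha
  obtain ⟨x, hx, y, hy, hxy⟩ := hG _ _ (hXY.mono h1 h2)
    (by rw [List.toFinset_card_of_nodup hA, List.length_map, hAk])
    (by rw [List.toFinset_card_of_nodup hB, List.length_map, hBk])
  have hR := hE x (h1 hx) y (h2 hy) hxy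
  obtain ⟨a, ha, rfl⟩ := List.mem_map.1 (List.mem_toFinset.1 hx)
  obtain ⟨b, hb, rfl⟩ := List.mem_map.1 (List.mem_toFinset.1 hy)
  exact ⟨a, ha, b, hb, hR⟩

theorem IsPathIn.exists_append {V : Type*} [DecidableEq V] {Adj R : V → V → Prop} {k : ℕ}
    (hG : IsJoined Adj k) {X Y U : Finset V} (hXY : Disjoint X Y) (hE : EdgesIn Adj R X Y)
    (hX : X ⊆ U) (hY : Y ⊆ U) {P Q : List V} (hP : IsPathIn R X P) (hQ : IsPathIn R Y Q) :
    ∃ W, IsPathIn R U W ∧ P.length + Q.length ≤ W.length + 2 * k := by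
  obtain ⟨hPn, hPc, hPX⟩ := hP
  obtain ⟨hQn, hQc, hQY⟩ := hQ
  obtain ⟨P', Q', hP', hQ', h1, h2, hc⟩ := exists_chain_append (k := k) hPc hQc
    (fun A B hA hB hAk hBk => hG.exists_list hXY hE (f := id) (g := id)
      (by simpa using hPn.sublist hA) (by simpa using hQn.sublist hB)
      (fun a ha => hPX a (hA.subset ha)) (fun a ha => hQY a (hB.subset ha)) hAk hBk)
  refine ⟨P' ++ Q', ⟨?_, hc, ?_⟩, by simp; omega⟩
  · refine List.nodup_append.2 ⟨hPn.sublist hP', hQn.sublist hQ', ?_⟩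
    rintro a ha b hb rfl
    exact Finset.disjoint_left.1 hXY (hPX a (hP'.subset ha)) (hQY a (hQ'.subset hb))
  · intro v hv
    rcases List.mem_append.1 hv with hv | hv
    · exact hX (hPX v (hP'.subset hv))
    · exact hY (hQY v (hQ'.subset hv))

/-- The vertices of a pair, in order and without repetition. -/
def pairVertices {V : Type*} [DecidableEq V] (e : V × V) : List V :=
  if e.1 = e.2 then [e.1] else [e.1, e.2]

theorem pairVertices_head? {V : Type*} [DecidableEq V] (e : V × V) :
    (pairVertices e).head? = some e.1 := by
  unfold pairVertices; split_ifs <;> simp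

theorem pairVertices_getLast? {V : Type*} [DecidableEq V] (e : V × V) :
    (pairVertices e).getLast? = some e.2 := by
  unfold pairVertices; split_ifs with h <;> simp [h]

theorem mem_pairVertices {V : Type*} [DecidableEq V] {e : V × V} {v : V} :
    v ∈ pairVertices e ↔ v = e.1 ∨ v = e.2 := by
  unfold pairVertices; split_ifs with h <;> simp [h]

theorem pairVertices_ne_nil {V : Type*} [DecidableEq V] (e : V × V) : pairVertices e ≠ [] := by
  unfold pairVertices; split_ifs <;> simp

theorem nodup_pairVertices {V : Type*} [DecidableEq V] (e : V × V) : (pairVertices e).Nodup := by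
  unfold pairVertices; split_ifs with h <;> simp [h]

theorem length_le_length_flatMap_pairVertices {V : Type*} [DecidableEq V] (l : List (V × V)) :
    l.length ≤ (l.flatMap pairVertices).length := by
  induction l with
  | nil => simp
  | cons e l ih =>
    have := List.length_pos_of_ne_nil (pairVertices_ne_nil e)
    simp only [List.flatMap_cons, List.length_append, List.length_cons]
    omega

theorem isChain_flatMap_pairVertices {V : Type*} [DecidableEq V] {B : V → V → Prop}
    {l : List (V × V)} (hl : l.IsChain fun e f => B e.2 f.1)
    (he : ∀ e ∈ l, e.1 ≠ e.2 → B e.1 e.2) : (l.flatMap pairVertices).IsChain B := by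
  rw [List.flatMap_def, List.isChain_flatten, List.isChain_map]
  · constructor
    · intro p hp
      obtain ⟨e, hel, rfl⟩ := List.mem_map.1 hp
      unfold pairVertices
      split_ifs with h
      · simp
      · simpa using he e hel h
    · refine hl.imp fun e f h => ?_
      simp only [pairVertices_head?, pairVertices_getLast?]
      simpa using h
  · intro h
    obtain ⟨e, -, h⟩ := List.mem_map.1 h
    exact pairVertices_ne_nil e h

theorem flatMap_pairVertices_diag {V : Type*} [DecidableEq V] (l : List V) :
    (l.map fun v => (v, v)).flatMap pairVertices = l := by
  induction l with
  | nil => simp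
  | cons a l ih => simp [List.flatMap_cons, ih, pairVertices]

theorem isChain_diag {V : Type*} {B : V → V → Prop} {l : List V} (hl : l.IsChain B) :
    (l.map fun v => (v, v)).IsChain fun e f => B e.2 f.1 := by
  rw [List.isChain_map]; exact hl

/-- A matching whose edges run against the direction from `S` to `T` can be ordered, up to the
loss of few edges, so that consecutive edges are linked from `S` to `T`. -/
theorem exists_linked_matching {V : Type*} [DecidableEq V] {Adj B : V → V → Prop} {k : ℕ}
    (hG : IsJoined Adj k) {S T : Finset V} (hST : Disjoint S T) (hE : EdgesIn Adj B S T)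
    {M : List (V × V)} (h1 : (M.map Prod.fst).Nodup) (h2 : (M.map Prod.snd).Nodup)
    (hM : ∀ e ∈ M, e.1 ∈ T ∧ e.2 ∈ S) :
    ∃ Z : List (V × V), Z.Nodup ∧ (Z.IsChain fun e f => B e.2 f.1) ∧ (∀ e ∈ Z, e ∈ M) ∧
      M.length ≤ Z.length + 2 * k := by
  obtain ⟨X, Y, Z, hX, hY, hXY, hZn, hZc, hZ, hcard, hsum, hno⟩ :=
    exists_dfs (fun e f : V × V => B e.2 f.1) M.toFinset
  refine ⟨Z, hZn, hZc, fun e he => List.mem_toFinset.1 (hZ e he), ?_⟩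
  rw [List.toFinset_card_of_nodup h1.of_map] at hsum
  suffices X.card ≤ k by omega
  by_contra! hk
  obtain ⟨X', hX', hX'k⟩ := Finset.exists_subset_card_eq hk.le
  obtain ⟨Y', hY', hY'k⟩ := Finset.exists_subset_card_eq (hcard ▸ hk.le)
  have hXM : ∀ e ∈ X'.toList, e ∈ M := fun e he =>
    List.mem_toFinset.1 (hX (hX' (Finset.mem_toList.1 he)))
  have hYM : ∀ e ∈ Y'.toList, e ∈ M := fun e he =>
    List.mem_toFinset.1 (hY (hY' (Finset.mem_toList.1 he)))
  obtain ⟨e, he, f, hf, hef⟩ := hG.exists_list hST hE (f := Prod.snd) (g := Prod.fst)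
    (A := X'.toList) (B := Y'.toList)
    (X'.nodup_toList.map_on fun e he f hf h => List.inj_on_of_nodup_map h2 (hXM e he) (hXM f hf) h)
    (Y'.nodup_toList.map_on fun e he f hf h => List.inj_on_of_nodup_map h1 (hYM e he) (hYM f hf) h)
    (fun e he => (hM e (hXM e he)).2) (fun e he => (hM e (hYM e he)).1)
    (by simpa using hX'k) (by simpa using hY'k)
  exact hno e (hX' (Finset.mem_toList.1 he)) f (hY' (Finset.mem_toList.1 hf)) hef

theorem IsPathIn.exists_append_matching {V : Type*} [DecidableEq V] {Adj B : V → V → Prop} {k : ℕ}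
    (hG : IsJoined Adj k) {S T S' T' U : Finset V} (hST : Disjoint S T)
    (hE : EdgesIn Adj B S T) (hS : S ⊆ U) (hT : T ⊆ U) (hS' : S' ⊆ S) (hT' : T' ⊆ T)
    {M : List (V × V)} (h1 : (M.map Prod.fst).Nodup) (h2 : (M.map Prod.snd).Nodup)
    (hM : ∀ e ∈ M, e.1 ∈ T ∧ e.1 ∉ T' ∧ e.2 ∈ S ∧ e.2 ∉ S' ∧ B e.1 e.2)
    {P Q : List V} (hP : IsPathIn B S' P) (hQ : IsPathIn B T' Q) :
    ∃ W, IsPathIn B U W ∧ P.length + M.length + Q.length ≤ W.length + 6 * k := by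
  obtain ⟨Z, hZn, hZc, hZM, hZlen⟩ := exists_linked_matching hG hST hE h1 h2
    fun e he => ⟨(hM e he).1, (hM e he).2.2.1⟩
  obtain ⟨hPn, hPc, hPS⟩ := hP
  obtain ⟨hQn, hQc, hQT⟩ := hQ
  have hdisj : ∀ s ∈ S, s ∉ T := fun s hs => Finset.disjoint_left.1 hST hs
  have hZ1 : (Z.map Prod.fst).Nodup := hZn.map_on fun e he f hf h =>
    List.inj_on_of_nodup_map h1 (hZM e he) (hZM f hf) h
  have hZ2 : (Z.map Prod.snd).Nodup := hZn.map_on fun e he f hf h =>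
    List.inj_on_of_nodup_map h2 (hZM e he) (hZM f hf) h
  set DP := P.map fun v => (v, v) with hDP
  set DQ := Q.map fun v => (v, v) with hDQ
  have hDPc : DP.IsChain fun e f => B e.2 f.1 := isChain_diag hPc
  have hDQc : DQ.IsChain fun e f => B e.2 f.1 := isChain_diag hQc
  have hDPl : DP.length = P.length := by simp [hDP]
  have hDQl : DQ.length = Q.length := by simp [hDQ]
  clear_value DP DQ
  have hDP2 : DP.map Prod.snd = P := by simp [hDP, Function.comp_def]
  have hDQ1 : DQ.map Prod.fst = Q := by simp [hDQ, Function.comp_def]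
  have hDPmem : ∀ e ∈ DP, e.1 = e.2 ∧ e.2 ∈ S' := by
    intro e he
    rw [hDP] at he
    obtain ⟨v, hv, rfl⟩ := List.mem_map.1 he
    exact ⟨rfl, hPS v hv⟩
  have hDQmem : ∀ e ∈ DQ, e.1 = e.2 ∧ e.1 ∈ T' := by
    intro e he
    rw [hDQ] at he
    obtain ⟨v, hv, rfl⟩ := List.mem_map.1 he
    exact ⟨rfl, hQT v hv⟩
  obtain ⟨P₁, Z₁, hP₁, hZ₁, hP₁l, hZ₁l, hc₁⟩ := exists_chain_append (k := k)
    hDPc hZc (fun A C hA hC hAk hCk => hG.exists_list hST hE (f := Prod.snd)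
      (g := Prod.fst) (by rw [← hDP2] at hPn; exact hPn.sublist (hA.map _))
      (hZ1.sublist (hC.map _)) (fun a ha => hS' (hDPmem a (hA.subset ha)).2)
      (fun a ha => (hM a (hZM a (hC.subset ha))).1) hAk hCk)
  have hsub₁ : (P₁ ++ Z₁).Sublist (DP ++ Z) := hP₁.append hZ₁
  have hexit : ∀ e ∈ DP ++ Z, e.2 ∈ S := by
    intro e he
    rcases List.mem_append.1 he with he | he
    · exact hS' (hDPmem e he).2
    · exact (hM e (hZM e he)).2.2.1
  have hexitn : ((DP ++ Z).map Prod.snd).Nodup := by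
    rw [List.map_append, List.nodup_append]
    refine ⟨by rwa [hDP2], hZ2, ?_⟩
    rintro a ha b hb rfl
    obtain ⟨e, he, rfl⟩ := List.mem_map.1 ha
    obtain ⟨f, hf, hfe⟩ := List.mem_map.1 hb
    exact (hM f (hZM f hf)).2.2.2.1 (hfe ▸ (hDPmem e he).2)
  obtain ⟨W, Q₁, hW, hQ₁, hWl, hQ₁l, hc₂⟩ := exists_chain_append (k := k)
    hc₁ hDQc (fun A C hA hC hAk hCk => hG.exists_list hST hE (f := Prod.snd)
      (g := Prod.fst) (hexitn.sublist ((hA.trans hsub₁).map _))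
      (by rw [← hDQ1] at hQn; exact hQn.sublist (hC.map _))
      (fun a ha => hexit a ((hA.trans hsub₁).subset ha))
      (fun a ha => hT' (hDQmem a (hC.subset ha)).2) hAk hCk)
  have hsub : (W ++ Q₁).Sublist ((DP ++ Z) ++ DQ) := (hW.trans hsub₁).append hQ₁
  have hZflat : (Z.flatMap pairVertices).Nodup := by
    rw [List.nodup_flatMap]
    refine ⟨fun e _ => nodup_pairVertices e, hZn.imp_of_mem fun {e f} he hf hne v hve hvf => ?_⟩
    obtain ⟨he1, -, he2, -⟩ := hM e (hZM e he)
    obtain ⟨hf1, -, hf2, -⟩ := hM f (hZM f hf)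
    rw [mem_pairVertices] at hve hvf
    rcases hve with rfl | rfl <;> rcases hvf with h | h
    · exact hne (List.inj_on_of_nodup_map h1 (hZM e he) (hZM f hf) h)
    · exact hdisj _ hf2 (h ▸ he1)
    · exact hdisj _ he2 (h ▸ hf1)
    · exact hne (List.inj_on_of_nodup_map h2 (hZM e he) (hZM f hf) h)
  have hflat : ((DP ++ Z ++ DQ).flatMap pairVertices).Nodup := by
    rw [List.flatMap_append, List.flatMap_append, hDP, hDQ, flatMap_pairVertices_diag,
      flatMap_pairVertices_diag, List.nodup_append, List.nodup_append]
    refine ⟨⟨hPn, hZflat, ?_⟩, hQn, ?_⟩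
    · rintro a ha b hb rfl
      obtain ⟨e, he, hae⟩ := List.mem_flatMap.1 hb
      have hMe := hM e (hZM e he)
      rcases mem_pairVertices.1 hae with rfl | rfl
      · exact hdisj _ (hS' (hPS _ ha)) hMe.1
      · exact hMe.2.2.2.1 (hPS _ ha)
    · rintro a ha b hb rfl
      rcases List.mem_append.1 ha with ha | ha
      · exact hdisj _ (hS' (hPS a ha)) (hT' (hQT a hb))
      · obtain ⟨e, he, hae⟩ := List.mem_flatMap.1 ha
        have hMe := hM e (hZM e he)
        rcases mem_pairVertices.1 hae with rfl | rfl
        · exact hMe.2.1 (hQT _ hb)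
        · exact hdisj _ hMe.2.2.1 (hT' (hQT _ hb))
  refine ⟨(W ++ Q₁).flatMap pairVertices, ⟨hflat.sublist (hsub.flatMap _),
    isChain_flatMap_pairVertices hc₂ ?_, ?_⟩, ?_⟩
  · intro e he hne
    have := hsub.subset he
    simp only [List.mem_append] at this
    rcases this with (h | h) | h
    · exact absurd (hDPmem e h).1 hne
    · exact (hM e (hZM e h)).2.2.2.2
    · exact absurd (hDQmem e h).1 hne
  · intro v hv
    obtain ⟨e, he, hve⟩ := List.mem_flatMap.1 hv
    have := hsub.subset he
    simp only [List.mem_append] at this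
    rcases this with (h | h) | h
    · have h' := hDPmem e h
      rcases mem_pairVertices.1 hve with rfl | rfl
      · exact hS (hS' (h'.1 ▸ h'.2))
      · exact hS (hS' h'.2)
    · have h' := hM e (hZM e h)
      rcases mem_pairVertices.1 hve with rfl | rfl
      · exact hT h'.1
      · exact hS h'.2.2.1
    · have h' := hDQmem e h
      rcases mem_pairVertices.1 hve with rfl | rfl
      · exact hT (hT' h'.2)
      · exact hT (hT' (h'.1 ▸ h'.2))
  · have h3 := length_le_length_flatMap_pairVertices (W ++ Q₁)
    have h6 : (W ++ Q₁).length = W.length + Q₁.length := List.length_append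
    have h7 : (P₁ ++ Z₁).length = P₁.length + Z₁.length := List.length_append
    omega

/-- A sequence of disjoint subsets of `U`, of size at least `2 * k`, such that all edges from
earlier sets to later sets belong to `R`. -/
def IsSetChain {V : Type*} (Adj R : V → V → Prop) (k : ℕ) (U : Finset V)
    (C : List (Finset V)) : Prop :=
  (∀ X ∈ C, X ⊆ U ∧ 2 * k ≤ X.card) ∧ C.Pairwise fun X Y => Disjoint X Y ∧ EdgesIn Adj R X Y

theorem IsSetChain.append {V : Type*} {Adj R : V → V → Prop} {k : ℕ} {X Y U : Finset V}
    (hXY : Disjoint X Y) (hE : EdgesIn Adj R X Y) (hX : X ⊆ U) (hY : Y ⊆ U)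
    {C D : List (Finset V)} (hC : IsSetChain Adj R k X C) (hD : IsSetChain Adj R k Y D) :
    IsSetChain Adj R k U (C ++ D) := by
  refine ⟨fun A hA => ?_, List.pairwise_append.2 ⟨hC.2, hD.2, fun A hA B hB => ?_⟩⟩
  · rcases List.mem_append.1 hA with hA | hA
    · exact ⟨(hC.1 A hA).1.trans hX, (hC.1 A hA).2⟩
    · exact ⟨(hD.1 A hA).1.trans hY, (hD.1 A hA).2⟩
  · exact ⟨hXY.mono (hC.1 A hA).1 (hD.1 B hB).1, hE.mono (hC.1 A hA).1 (hD.1 B hB).1⟩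

theorem IsSetChain.exists_starts {V : Type*} [DecidableEq V] {Adj R : V → V → Prop} {k : ℕ}
    (hk : 0 < k) (hG : IsJoined Adj k) {U : Finset V} {X : Finset V} {C : List (Finset V)}
    (hC : IsSetChain Adj R k U (X :: C)) :
    ∃ A ⊆ X, k ≤ A.card ∧ ∀ a ∈ A, ∃ P : List V, P.length = C.length ∧ (a :: P).Nodup ∧
      (a :: P).IsChain R ∧ ∀ v ∈ P, ∃ Y ∈ C, v ∈ Y := by
  classical
  induction C generalizing X with
  | nil =>
    exact ⟨X, subset_rfl, by have := (hC.1 X (by simp)).2; omega, fun a _ => ⟨[], by simp⟩⟩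
  | cons Y C ih =>
    obtain ⟨hmem, hpw⟩ := hC
    rw [List.pairwise_cons] at hpw
    obtain ⟨A, hAY, hAk, hA⟩ := ih (X := Y) ⟨fun Z hZ => hmem Z (List.mem_cons_of_mem _ hZ), hpw.2⟩
    refine ⟨X.filter fun x => ∃ y ∈ A, R x y, Finset.filter_subset _ _, ?_, ?_⟩
    · by_contra! hlt
      have hsum := Finset.card_filter_add_card_filter_not (s := X) fun x => ∃ y ∈ A, R x y
      have hX := (hmem X (by simp)).2
      obtain ⟨X', hX', hX'k⟩ := Finset.exists_subset_card_eq
        (s := X.filter fun x => ¬ ∃ y ∈ A, R x y) (n := k) (by omega)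
      obtain ⟨A', hA', hA'k⟩ := Finset.exists_subset_card_eq hAk
      have hXY := hpw.1 Y (by simp)
      obtain ⟨x, hx, y, hy, hxy⟩ := hG X' A'
        (hXY.1.mono (hX'.trans (Finset.filter_subset _ _)) (hA'.trans hAY)) hX'k hA'k
      have hx' := Finset.mem_filter.1 (hX' hx)
      exact hx'.2 ⟨y, hA' hy, hXY.2 x hx'.1 y (hAY (hA' hy)) hxy⟩
    · intro x hx
      obtain ⟨hxX, y, hy, hxy⟩ := Finset.mem_filter.1 hx
      obtain ⟨P, hPl, hPn, hPc, hP⟩ := hA y hy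
      have hcov : ∀ v ∈ y :: P, ∃ Z ∈ Y :: C, v ∈ Z := by
        intro v hv
        rcases List.mem_cons.1 hv with rfl | hv
        · exact ⟨Y, by simp, hAY hy⟩
        · obtain ⟨Z, hZ, hvZ⟩ := hP v hv
          exact ⟨Z, by simp [hZ], hvZ⟩
      refine ⟨y :: P, by simp [hPl], List.nodup_cons.2 ⟨fun h => ?_, hPn⟩,
        List.isChain_cons_cons.2 ⟨hxy, hPc⟩, hcov⟩
      obtain ⟨Z, hZ, hxZ⟩ := hcov x h
      exact Finset.disjoint_left.1 (hpw.1 Z hZ).1 hxX hxZ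

theorem IsSetChain.exists_path {V : Type*} [DecidableEq V] {Adj R : V → V → Prop} {k : ℕ}
    (hk : 0 < k) (hG : IsJoined Adj k) {U : Finset V} {C : List (Finset V)}
    (hC : IsSetChain Adj R k U C) : ∃ P : List V, P.length = C.length ∧ P.Nodup ∧ P.IsChain R := by
  cases C with
  | nil => exact ⟨[], by simp⟩
  | cons X C =>
    obtain ⟨A, -, hA, h⟩ := hC.exists_starts hk hG
    obtain ⟨a, ha⟩ := Finset.card_pos.1 (hk.trans_le hA)
    obtain ⟨P, hPl, hPn, hPc, -⟩ := h a ha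
    exact ⟨a :: P, by simp [hPl], hPn, hPc⟩

theorem exists_paths_and_setChain {V : Type*} [DecidableEq V] {Adj R B : V → V → Prop} {k : ℕ}
    (hG : IsJoined Adj k) (hRB : ∀ u v, Adj u v → R u v ∨ B u v) (d : ℕ) (U : Finset V)
    (hU : U.card ≤ 2 ^ d * (72 * k)) :
    ∃ (P Q : List V) (C : List (Finset V)), IsPathIn R U P ∧ IsPathIn B U Q ∧
      IsSetChain Adj R k U C ∧ U.card + 12 * k * (d + 2) ≤
        d * P.length + 2 * Q.length + 36 * k * 2 ^ d + 72 * k * C.length := by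
  induction d generalizing U with
  | zero =>
    have hnil : ∀ R : V → V → Prop, IsPathIn R U [] := fun R => by simp [IsPathIn]
    rcases lt_or_ge U.card (2 * k) with h | h
    · exact ⟨[], [], [], hnil R, hnil B, by simp [IsSetChain], by simp; omega⟩
    · exact ⟨[], [], [U], hnil R, hnil B, by simp [IsSetChain, h], by simp at hU ⊢; omega⟩
  | succ d ih =>
    obtain ⟨S, T, P, hS, hT, hST, hPn, hPc, hPU, hcard, hsum, hno⟩ := exists_dfs R U
    obtain ⟨M, S', T', hS', hT', hc1, hc2, h1, h2, hM, hno'⟩ := exists_maximal_matching B hcard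
    have hEB : EdgesIn Adj B S T := fun s hs t ht h => (hRB s t h).resolve_left (hno s hs t ht)
    have hER : EdgesIn Adj R T' S' := fun t ht s hs h => (hRB t s h).resolve_right (hno' t ht s hs)
    rw [pow_succ, mul_right_comm] at hU
    obtain ⟨P₁, Q₁, C₁, hP₁, hQ₁, hC₁, hle₁⟩ := ih S' (by omega)
    obtain ⟨P₂, Q₂, C₂, hP₂, hQ₂, hC₂, hle₂⟩ := ih T' (by omega)
    have hTS' : Disjoint T' S' := (hST.mono hS' hT').symm
    obtain ⟨Q, hQ, hQl⟩ := hQ₁.exists_append_matching hG hST hEB hS hT hS' hT' h1 h2 hM hQ₂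
    obtain ⟨P', hP', hP'l⟩ := hP₂.exists_append hG hTS' hER (hT'.trans hT) (hS'.trans hS) hP₁
    have hC := hC₂.append hTS' hER (hT'.trans hT) (hS'.trans hS) hC₁
    obtain ⟨P₀, hP₀, hl, hl'⟩ : ∃ P₀, IsPathIn R U P₀ ∧ P.length ≤ P₀.length ∧
        P'.length ≤ P₀.length := by
      rcases le_total P.length P'.length with h | h
      · exact ⟨P', hP', h, le_rfl⟩
      · exact ⟨P, ⟨hPn, hPc, hPU⟩, le_rfl, h⟩
    refine ⟨P₀, Q, C₂ ++ C₁, hP₀, hQ, hC, ?_⟩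
    have h3 : d * (P₂.length + P₁.length) ≤ d * (P₀.length + 2 * k) :=
      Nat.mul_le_mul_left d (by omega)
    rw [List.length_append, pow_succ]
    nlinarith [Nat.zero_le (d * k)]

theorem exists_isDiPath_of_list {V : Type} {Adj : V → V → Prop} {col : V → V → Bool} {c : Bool}
    {P : List V} (hn : P.Nodup) (hc : P.IsChain fun u v => Adj u v ∧ col u v = c) {n : ℕ}
    (hP : n < P.length) :
    ∃ m : ℕ, n ≤ m ∧ ∃ p : Fin (m + 1) → V, IsDiPath Adj p ∧ IsColored col c p := by
  rw [List.isChain_iff_getElem] at hc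
  refine ⟨n, le_rfl, fun i => P[(i : ℕ)], ⟨fun i j hij => ?_, fun i => ?_⟩, fun i => ?_⟩
  · exact Fin.ext ((hn.getElem_inj_iff).1 hij)
  · exact (hc i (by omega)).1
  · exact (hc i (by omega)).2

theorem exists_monochromatic_path {V : Type} [Fintype V] {Adj : V → V → Prop} {n d m : ℕ}
    (hn : 0 < n) (hd : 0 < d) (hG : IsJoined Adj (4 * d)) (hnd : 4 * n ≤ 2 ^ d) (hm : m ≤ n * d)
    (hV : Fintype.card V = 2 ^ d * (72 * (4 * d))) (col : V → V → Bool) :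
    (∃ l : ℕ, n ≤ l ∧ ∃ p : Fin (l + 1) → V, IsDiPath Adj p ∧ IsColored col true p) ∨
      ∃ l : ℕ, m ≤ l ∧ ∃ p : Fin (l + 1) → V, IsDiPath Adj p ∧ IsColored col false p := by
  classical
  obtain ⟨P, Q, C, hP, hQ, hC, hle⟩ := exists_paths_and_setChain (Adj := Adj)
    (R := fun u v => Adj u v ∧ col u v = true) (B := fun u v => Adj u v ∧ col u v = false) hG
    (fun u v h => by cases hcol : col u v <;> simp [h]) d Finset.univ
    (by rw [Finset.card_univ, hV])
  rw [Finset.card_univ, hV] at hle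
  by_contra! hcon
  obtain ⟨hred, hblue⟩ := hcon
  obtain ⟨P', hP'l, hP'n, hP'c⟩ := hC.exists_path (by omega) hG
  have long : ∀ {c : Bool} {n : ℕ} {P : List V}, (∀ l : ℕ, n ≤ l → ∀ p : Fin (l + 1) → V,
      IsDiPath Adj p → ¬ IsColored col c p) → P.Nodup →
      (P.IsChain fun u v => Adj u v ∧ col u v = c) → P.length ≤ n := by
    intro c n P h hn hc
    by_contra! hlt
    obtain ⟨l, hl, p, hp, hpc⟩ := exists_isDiPath_of_list hn hc hlt
    exact h l hl p hp hpc
  have h1 : P.length ≤ n := long hred hP.1 hP.2.1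
  have h2 : Q.length ≤ m := long hblue hQ.1 hQ.2.1
  have h3 : C.length ≤ n := hP'l ▸ long hred hP'n hP'c
  have h4 := Nat.mul_le_mul_left d h1
  have h5 := Nat.mul_le_mul_left (72 * (4 * d)) h3
  have h6 := Nat.mul_le_mul_left (36 * (4 * d)) hnd
  have h7 : 0 < n * d := Nat.mul_pos hn hd
  nlinarith [Nat.zero_le (d * d)]

theorem mul_lt_two_pow {d : ℕ} (hd : 12 ≤ d) : 288 * d < 2 ^ d := by
  induction d, hd using Nat.le_induction with
  | base => norm_num
  | succ d hd ih => rw [pow_succ]; omega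

/-- There are `c > 0` and `n₀` such that for every `n ≥ n₀` there is an oriented graph
with at most `c · n² · (log n)²` edges such that every red-blue coloring of its edges
contains a red directed path with at least `n` edges or a blue directed path with at
least `⌊n · log n⌋` edges. Logarithms are base 2; red is `true`, blue is `false`. -/
theorem stmt_3 :
    ∃ (c : ℝ) (n₀ : ℕ), 0 < c ∧
      ∀ n : ℕ, n₀ ≤ n →
        ∃ (V : Type) (_ : Fintype V) (Adj : V → V → Prop),
          IsOriented Adj ∧
          (({e : V × V | Adj e.1 e.2}.ncard : ℝ) ≤
            c * (n : ℝ) ^ 2 * (Real.logb 2 n) ^ 2) ∧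
          ∀ col : V → V → Bool,
            (∃ m : ℕ, n ≤ m ∧ ∃ p : Fin (m + 1) → V,
              IsDiPath Adj p ∧ IsColored col true p) ∨
            (∃ m : ℕ, ⌊(n : ℝ) * Real.logb 2 n⌋₊ ≤ m ∧ ∃ p : Fin (m + 1) → V,
              IsDiPath Adj p ∧ IsColored col false p) := by
  refine ⟨4608 ^ 2, 512, by norm_num, fun n hn => ?_⟩
  have hn0 : n ≠ 0 := by omega
  have hnR : (0 : ℝ) < n := by exact_mod_cast Nat.pos_of_ne_zero hn0
  obtain ⟨e, he⟩ : ∃ e, e = Nat.log 2 n := ⟨_, rfl⟩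
  have hle : 2 ^ e ≤ n := he ▸ Nat.pow_log_le_self 2 hn0
  have hlt : n < 2 ^ (e + 1) := he ▸ Nat.lt_pow_succ_log_self (by norm_num) n
  have he9 : 9 ≤ e := he ▸ Nat.le_log_of_pow_le (by norm_num) (by omega)
  have hlog_ge : (e : ℝ) ≤ Real.logb 2 n := by
    rw [Real.le_logb_iff_rpow_le (by norm_num) hnR, Real.rpow_natCast]
    exact_mod_cast hle
  have hlog_le : Real.logb 2 n ≤ (e + 3 : ℕ) := by
    rw [Real.logb_le_iff_le_rpow (by norm_num) hnR, Real.rpow_natCast]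
    have : n ≤ 2 ^ (e + 3) := hlt.le.trans (Nat.pow_le_pow_right (by norm_num) (by omega))
    exact_mod_cast this
  set N := 2 ^ (e + 3) * (72 * (4 * (e + 3))) with hN
  have hNlt : N < 2 ^ (e + 3) * 2 ^ (e + 3) := by
    refine Nat.mul_lt_mul_of_pos_left ?_ (by positivity)
    have := mul_lt_two_pow (d := e + 3) (by omega)
    omega
  obtain ⟨Adj, hor, hG⟩ := exists_tournament_isJoined (N := N) (k := 4 * (e + 3)) (by
    calc (N ^ (4 * (e + 3))) ^ 2
        < ((2 ^ (e + 3) * 2 ^ (e + 3)) ^ (4 * (e + 3))) ^ 2 :=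
          Nat.pow_lt_pow_left (Nat.pow_lt_pow_left hNlt (by omega)) (by norm_num)
      _ = 2 ^ (4 * (e + 3) * (4 * (e + 3))) := by
          rw [← pow_add, ← pow_mul, ← pow_mul]
          congr 1
          ring)
  refine ⟨Fin N, inferInstance, Adj, hor, ?_, ?_⟩
  · have h1 : {e : Fin N × Fin N | Adj e.1 e.2}.ncard ≤ N * N := by
      refine (Set.ncard_le_card _).trans ?_
      simp
    have h2 : (N : ℝ) ≤ 4608 * (n * Real.logb 2 n) := by
      have h3 : N ≤ 4608 * (n * e) := by
        have h4 : N ≤ 8 * n * (72 * (8 * e)) := by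
          rw [hN, pow_add]
          exact Nat.mul_le_mul (by omega) (by omega)
        linarith
      calc (N : ℝ) ≤ ((4608 * (n * e) : ℕ) : ℝ) := by exact_mod_cast h3
        _ = 4608 * (n * (e : ℝ)) := by push_cast; ring
        _ ≤ _ := by gcongr
    calc _ ≤ ((N * N : ℕ) : ℝ) := by exact_mod_cast h1
      _ = (N : ℝ) ^ 2 := by push_cast; ring
      _ ≤ (4608 * (n * Real.logb 2 n)) ^ 2 := by gcongr
      _ = _ := by ring
  · refine exists_monochromatic_path (d := e + 3) (by omega) (by omega) hG ?_ ?_ (by simp [hN])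
    · rw [pow_succ] at hlt
      rw [pow_add]
      omega
    · refine Nat.floor_le_of_le ?_
      push_cast at hlog_le ⊢
      gcongr
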